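/- (Furstenberg multiple recurrence theorem) Let (X, 𝓑, μ) be a probability space and let T₁, …, T_k be pairwise commuting measurable measure-preserving maps on X. Let A ∈ 𝓑 with μ(A) > 0. Then there is n ≥ 1 such that μ(⋂_{1≤i≤k} T_i^{-n}(A)) > 0. -/

import Mathlib

open MeasureTheory

namespace DensityHalesJewett

open Combinatorics

/-- The average of a real-valued function over a finite type. -/
noncomputable def avg {X : Type*} (f : X → ℝ) : ℝ := (∑ᶠ x, f x) / Nat.card X

/-- The density of a subset of a finite type. -/
noncomputable def dens {X : Type*} (A : Set X) : ℝ := avg (A.indicator 1)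

section Avg

variable {X Y : Type*}

lemma avg_eq [Fintype X] (f : X → ℝ) : avg f = (∑ x, f x) / Fintype.card X := by
  rw [avg, finsum_eq_sum_of_fintype, Nat.card_eq_fintype_card]

lemma avg_equiv (e : X ≃ Y) (f : Y → ℝ) : avg (fun x => f (e x)) = avg f := by
  rw [avg, avg, Nat.card_congr e]
  congr 1
  exact finsum_comp_equiv e

/-- The contribution of the image of an injective map to an average. -/
lemma avg_indicator_range {i : Y → X} [Finite Y] [Nonempty Y] (hi : Function.Injective i)
    (f : X → ℝ) :
    avg ((Set.range i).indicator f) = Nat.card Y / Nat.card X * avg (fun y => f (i y)) := by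
  have hY : (Nat.card Y : ℝ) ≠ 0 := Nat.cast_ne_zero.2 Nat.card_pos.ne'
  have : ∑ᶠ x, (Set.range i).indicator f x = ∑ᶠ y, f (i y) := by
    rw [← finsum_mem_def, finsum_mem_range hi]
  rw [avg, avg, this]
  field_simp

lemma indicator_one_nonneg (A : Set X) (x : X) : (0 : ℝ) ≤ A.indicator 1 x :=
  Set.indicator_nonneg (fun _ _ => zero_le_one) x

lemma indicator_one_le_one (A : Set X) (x : X) : A.indicator (1 : X → ℝ) x ≤ 1 :=
  Set.indicator_le' (fun _ _ => le_rfl) (fun _ _ => zero_le_one) x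

variable [Finite X] [Finite Y]

lemma avg_mono {f g : X → ℝ} (h : ∀ x, f x ≤ g x) : avg f ≤ avg g := by
  cases nonempty_fintype X
  rw [avg_eq, avg_eq]
  gcongr
  exact h _

lemma avg_add (f g : X → ℝ) : avg (fun x => f x + g x) = avg f + avg g := by
  cases nonempty_fintype X
  simp only [avg_eq, Finset.sum_add_distrib, add_div]

lemma avg_sub (f g : X → ℝ) : avg (fun x => f x - g x) = avg f - avg g := by
  cases nonempty_fintype X
  simp only [avg_eq, Finset.sum_sub_distrib, sub_div]

lemma avg_const_mul (c : ℝ) (f : X → ℝ) : avg (fun x => c * f x) = c * avg f := by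
  cases nonempty_fintype X
  simp only [avg_eq, ← Finset.mul_sum, mul_div_assoc]

lemma avg_const [Nonempty X] (c : ℝ) : avg (fun _ : X => c) = c := by
  cases nonempty_fintype X
  simp [avg_eq]

lemma avg_sum {L : Type*} [Fintype L] (f : L → X → ℝ) :
    avg (fun x => ∑ l, f l x) = ∑ l, avg (f l) := by
  cases nonempty_fintype X
  simp only [avg_eq, ← Finset.sum_div]
  rw [Finset.sum_comm]

lemma avg_comm (f : X → Y → ℝ) :
    avg (fun x => avg (fun y => f x y)) = avg (fun y => avg (fun x => f x y)) := by
  cases nonempty_fintype X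
  cases nonempty_fintype Y
  simp only [avg_eq, ← Finset.sum_div]
  rw [Finset.sum_comm, div_right_comm]

lemma avg_prod (f : X × Y → ℝ) : avg f = avg (fun x => avg (fun y => f (x, y))) := by
  cases nonempty_fintype X
  cases nonempty_fintype Y
  simp only [avg_eq, ← Finset.sum_div, Fintype.sum_prod_type, Fintype.card_prod, Nat.cast_mul,
    div_div]
  rw [mul_comm (Fintype.card X : ℝ)]

lemma avg_nonneg {f : X → ℝ} (h : ∀ x, 0 ≤ f x) : 0 ≤ avg f := by
  cases nonempty_fintype X
  rw [avg_eq]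
  exact div_nonneg (Finset.sum_nonneg fun x _ => h x) (Nat.cast_nonneg _)

lemma avg_le_of_forall_le [Nonempty X] {f : X → ℝ} {c : ℝ} (h : ∀ x, f x ≤ c) : avg f ≤ c :=
  (avg_mono h).trans_eq (avg_const c)

lemma dens_nonneg (A : Set X) : 0 ≤ dens A := avg_nonneg (indicator_one_nonneg A)

lemma dens_le_one [Nonempty X] (A : Set X) : dens A ≤ 1 :=
  avg_le_of_forall_le (indicator_one_le_one A)

lemma dens_eq_ncard (A : Set X) : dens A = A.ncard / Nat.card X := by
  classical
  cases nonempty_fintype X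
  rw [dens, avg_eq, Nat.card_eq_fintype_card, Finset.sum_indicator_eq_sum_filter]
  simp [Set.ncard_eq_toFinset_card']

/-- If the fibres of a relation have average density at least `δ`, and every fibre of density at
least `δ / 2` is witnessed by one of finitely many labels, then some label is popular. -/
lemma exists_popular [Nonempty Y] {L : Type*} [Finite L] (E : Y → Set X) {δ : ℝ} (hδ : 0 < δ)
    (hE : δ ≤ avg (fun y => dens (E y))) (P : L → Set Y)
    [Nonempty X] (h : ∀ y, δ / 2 ≤ dens (E y) → ∃ l, y ∈ P l) :
    ∃ l, δ / (2 * Nat.card L) ≤ dens (P l) := by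
  cases nonempty_fintype L
  by_contra! hcon
  have hpt : ∀ y, dens (E y) ≤ δ / 2 + ∑ l, (P l).indicator (1 : Y → ℝ) y := by
    intro y
    have h0 : 0 ≤ ∑ l, (P l).indicator (1 : Y → ℝ) y :=
      Finset.sum_nonneg fun l _ => indicator_one_nonneg _ _
    by_cases hy : δ / 2 ≤ dens (E y)
    · obtain ⟨l, hl⟩ := h y hy
      have h1 : (P l).indicator (1 : Y → ℝ) y ≤ ∑ l, (P l).indicator (1 : Y → ℝ) y :=
        Finset.single_le_sum (f := fun l => (P l).indicator (1 : Y → ℝ) y)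
          (fun l _ => indicator_one_nonneg _ _) (Finset.mem_univ l)
      rw [Set.indicator_of_mem hl, Pi.one_apply] at h1
      linarith [dens_le_one (E y)]
    · linarith
  have h2 := avg_mono hpt
  rw [avg_add, avg_const, avg_sum] at h2
  rcases isEmpty_or_nonempty L with hL | hL
  · simp at h2
    linarith
  · have h3 : ∑ l, avg ((P l).indicator 1) < ∑ _l : L, δ / (2 * Nat.card L) :=
      Finset.sum_lt_sum_of_nonempty Finset.univ_nonempty fun l _ => hcon l
    have h4 : ∑ _l : L, δ / (2 * Nat.card L) = δ / 2 := by
      have : (Fintype.card L : ℝ) ≠ 0 := by simp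
      simp
      field_simp
    linarith

end Avg

/-! ### Subspaces of words -/

section Words

variable {α β η ζ ι : Type*}

/-- A subspace over the alphabet `α` evaluated on words over the alphabet `Option α`. -/
def lift (V : Subspace η α ι) : Subspace η (Option α) ι where
  idxFun i := (V.idxFun i).map some id
  proper e := by
    obtain ⟨i, hi⟩ := V.proper e
    exact ⟨i, by simp [hi]⟩

/-- Composition of subspaces. -/
def comp (V : Subspace η β ι) (W : Subspace ζ β η) : Subspace ζ β ι where
  idxFun i := (V.idxFun i).elim Sum.inl W.idxFun
  proper e := by
    obtain ⟨j, hj⟩ := W.proper e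
    obtain ⟨i, hi⟩ := V.proper j
    exact ⟨i, by simp [hi, hj]⟩

lemma comp_apply (V : Subspace η β ι) (W : Subspace ζ β η) (x : ζ → β) :
    comp V W x = V (W x) := by
  funext i
  simp only [Subspace.coe_apply, comp]
  cases V.idxFun i <;> simp [Subspace.coe_apply]

lemma lift_comp (V : Subspace η α ι) (W : Subspace ζ α η) :
    lift (comp V W) = comp (lift V) (lift W) := by
  simp only [lift, comp, Subspace.mk.injEq]
  funext i
  cases V.idxFun i <;> simp

lemma subspace_injective (V : Subspace η β ι) : Function.Injective V := by
  intro x y h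
  funext e
  obtain ⟨i, hi⟩ := V.proper e
  have := congrFun h i
  rwa [Subspace.apply_inr hi, Subspace.apply_inr hi] at this

/-- Replace the letter `none` by the letter `a`. -/
def fill (a : α) (x : ι → Option α) : ι → α := fun i => (x i).getD a

lemma fill_some (a : α) (x : ι → α) : fill a (fun i => some (x i)) = x := rfl

lemma fill_lift (V : Subspace η α ι) (a : α) (x : η → Option α) :
    fill a (lift V x) = V (fill a x) := by
  funext i
  simp only [fill, Subspace.coe_apply, lift]
  cases V.idxFun i <;> simp [fill]

lemma lift_some (V : Subspace η α ι) (x : η → α) :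
    lift V (fun i => some (x i)) = fun i => some (V x i) := by
  funext i
  simp only [Subspace.coe_apply, lift]
  cases V.idxFun i <;> simp

/-- The line obtained by composing a line with a subspace. -/
def lineComp (V : Subspace η β ι) (l : Line β η) : Line β ι where
  idxFun := lift V l.idxFun
  proper := by
    obtain ⟨e, he⟩ := l.proper
    obtain ⟨i, hi⟩ := V.proper e
    exact ⟨i, by simp [Subspace.coe_apply, lift, hi, he]⟩

lemma lineComp_apply (V : Subspace η β ι) (l : Line β η) (b : β) :
    lineComp V l b = V (l b) := fill_lift V b l.idxFun

/-- The subspace whose free coordinates are given by a partial labelling. -/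
def ofLabel (f : ι → Option η) (hf : ∀ e, ∃ i, f i = some e) (b : β) : Subspace η β ι where
  idxFun i := (f i).elim (Sum.inl b) Sum.inr
  proper e := by
    obtain ⟨i, hi⟩ := hf e
    exact ⟨i, by simp [hi]⟩

/-- Glue two words along a decomposition of the set of coordinates. -/
def merge {ι₁ ι₂ : Type*} (e : ι ≃ ι₁ ⊕ ι₂) (u : ι₁ → β) (v : ι₂ → β) : ι → β :=
  fun i => Sum.elim u v (e i)

/-- The subspace of all words with prescribed second part. -/
def horizontal {ι₁ ι₂ : Type*} (e : ι ≃ ι₁ ⊕ ι₂) (v : ι₂ → β) : Subspace ι₁ β ι where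
  idxFun i := Sum.elim Sum.inr (fun j => Sum.inl (v j)) (e i)
  proper j := ⟨e.symm (Sum.inl j), by simp⟩

lemma horizontal_apply {ι₁ ι₂ : Type*} (e : ι ≃ ι₁ ⊕ ι₂) (v : ι₂ → β) (u : ι₁ → β) :
    horizontal e v u = merge e u v := by
  funext i
  simp only [Subspace.coe_apply, horizontal, merge]
  cases e i <;> rfl

/-- The subspace of all words with prescribed first part. -/
def vertical {ι₁ ι₂ : Type*} (e : ι ≃ ι₁ ⊕ ι₂) (u : ι₁ → β) : Subspace ι₂ β ι where
  idxFun i := Sum.elim (fun j => Sum.inl (u j)) Sum.inr (e i)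
  proper j := ⟨e.symm (Sum.inr j), by simp⟩

lemma vertical_apply {ι₁ ι₂ : Type*} (e : ι ≃ ι₁ ⊕ ι₂) (u : ι₁ → β) (v : ι₂ → β) :
    vertical e u v = merge e u v := by
  funext i
  simp only [Subspace.coe_apply, vertical, merge]
  cases e i <;> rfl

lemma avg_merge {ι₁ ι₂ : Type*} [Finite ι₁] [Finite ι₂] [Finite β] (e : ι ≃ ι₁ ⊕ ι₂)
    (f : (ι → β) → ℝ) :
    avg f = avg (fun u : ι₁ → β => avg (fun v : ι₂ → β => f (merge e u v))) := by
  rw [← avg_equiv ((Equiv.sumArrowEquivProdArrow ι₁ ι₂ β).symm.trans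
    (e.symm.arrowCongr (Equiv.refl β))) f, avg_prod]
  rfl

lemma nonempty_equiv_sum {ι₁ : Type*} [Finite ι] [Finite ι₁] (h : Nat.card ι₁ ≤ Nat.card ι) :
    Nonempty (ι ≃ ι₁ ⊕ Fin (Nat.card ι - Nat.card ι₁)) := by
  refine ⟨(Finite.equivFinOfCardEq ?_).trans (Finite.equivFinOfCardEq rfl).symm⟩
  rw [Nat.card_sum, Nat.card_fin]
  omega

instance [Finite η] [Finite β] [Finite ι] : Finite (Subspace η β ι) :=
  Finite.of_injective Subspace.idxFun fun V W h => by cases V; cases W; simpa using h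

instance [Finite β] [Finite ι] : Finite (Line β ι) :=
  Finite.of_injective Line.idxFun fun V W h => by cases V; cases W; simpa using h

end Words

/-! ### Finite unions and parameter words -/

section Ramsey

/-- There are `r` disjoint nonempty sets, given as the fibres of a partial labelling, all of whose
nonempty unions satisfy `P`. -/
def HasUnions (ι : Type) (r : ℕ) (P : Set ι → Prop) : Prop :=
  ∃ g : ι → Option (Fin r), (∀ j, ∃ i, g i = some j) ∧
    ∀ J : Set (Fin r), J.Nonempty → P (g ⁻¹' (some '' J))

lemma hasUnions_zero (ι : Type) (P : Set ι → Prop) : HasUnions ι 0 P :=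
  ⟨fun _ => none, fun j => j.elim0, fun _ ⟨j, _⟩ => j.elim0⟩

lemma HasUnions.of_label {ι η : Type} {r : ℕ} {P : Set ι → Prop} (f : ι → Option η)
    (hf : ∀ e, ∃ i, f i = some e) (h : HasUnions η r fun K => P (f ⁻¹' (some '' K))) :
    HasUnions ι r P := by
  obtain ⟨g, hg, hP⟩ := h
  refine ⟨fun i => (f i).bind g, fun j => ?_, fun J hJ => ?_⟩
  · obtain ⟨e, he⟩ := hg j
    obtain ⟨i, hi⟩ := hf e
    exact ⟨i, by simp [hi, he]⟩
  · convert hP J hJ using 1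
    ext i
    simp only [Set.mem_preimage]
    cases f i <;> simp

lemma HasUnions.succ {ι η : Type} {r : ℕ} {P : Set ι → Prop} (f : ι → Option η)
    (hf : ∀ e, ∃ i, f i = some e) (T : Set ι) (hT : T.Nonempty) (hTf : ∀ i ∈ T, f i = none)
    (hP : ∀ K : Set η, P (T ∪ f ⁻¹' (some '' K)))
    (h : HasUnions η r fun K => P (f ⁻¹' (some '' K))) :
    HasUnions ι (r + 1) P := by
  classical
  obtain ⟨g, hg, hgP⟩ := h
  let g' : ι → Option (Fin (r + 1)) := fun i =>
    if i ∈ T then some 0 else ((f i).bind g).map Fin.succ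
  have key : ∀ J, g' ⁻¹' (some '' J) =
      {i | i ∈ T ∧ 0 ∈ J} ∪ f ⁻¹' (some '' (g ⁻¹' (some '' (Fin.succ ⁻¹' J)))) := by
    intro J
    ext i
    by_cases hi : i ∈ T
    · simp [g', hi, hTf i hi]
    · simp only [g', Set.mem_preimage, hi, if_false, false_and, Set.mem_union, Set.mem_ofPred_eq,
        false_or]
      rcases f i with _ | e
      · simp
      · rcases h' : g e with _ | j <;> simp [h']
  refine ⟨g', fun j => ?_, fun J hJ => ?_⟩
  · refine Fin.cases ?_ (fun j => ?_) j
    · obtain ⟨i, hi⟩ := hT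
      exact ⟨i, by simp [g', hi]⟩
    · obtain ⟨e, he⟩ := hg j
      obtain ⟨i, hi⟩ := hf e
      have : i ∉ T := fun h => by simp [hTf i h] at hi
      exact ⟨i, by simp [g', this, hi, he]⟩
  · rw [key]
    by_cases h0 : 0 ∈ J
    · simpa [h0] using hP (g ⁻¹' (some '' (Fin.succ ⁻¹' J)))
    · have : (Fin.succ ⁻¹' J).Nonempty := by
        obtain ⟨j, hj⟩ := hJ
        rcases Fin.eq_zero_or_eq_succ j with rfl | ⟨j', rfl⟩
        · exact absurd hj h0
        · exact ⟨j', hj⟩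
      simpa [h0] using hgP _ this

/-- Folkman's **finite unions theorem** for two colours. -/
theorem exists_hasUnions (r s : ℕ) : ∃ (ι : Type) (_ : Finite ι), ∀ P : Set ι → Prop,
    HasUnions ι r P ∨ HasUnions ι s fun K => ¬ P K := by
  induction r generalizing s with
  | zero => exact ⟨Empty, inferInstance, fun P => .inl (hasUnions_zero _ _)⟩
  | succ r ihr =>
  induction s with
  | zero => exact ⟨Empty, inferInstance, fun P => .inr (hasUnions_zero _ _)⟩
  | succ s ihs =>
  obtain ⟨ι₁, _, h₁⟩ := ihr (s + 1)
  obtain ⟨ι₂, _, h₂⟩ := ihs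
  obtain ⟨ι, hι, h⟩ := Subspace.exists_mono_in_high_dimension Prop Prop (ι₁ ⊕ ι₂)
  refine ⟨Option ι, inferInstance, fun P => ?_⟩
  obtain ⟨V, c, hV⟩ := h fun w => P {o | ∀ i, o = some i → w i}
  let T : Set (Option ι) := {o | ∀ i, o = some i → (V.idxFun i).elim id fun _ => False}
  let f : Option ι → Option (ι₁ ⊕ ι₂) := fun o => o.bind fun i => (V.idxFun i).getRight?
  have hf : ∀ e, ∃ i, f i = some e := fun e => by
    obtain ⟨i, hi⟩ := V.proper e
    exact ⟨some i, by simp [f, hi]⟩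
  have hT : T.Nonempty := ⟨none, by simp [T]⟩
  have hTf : ∀ i ∈ T, f i = none := by
    rintro (_ | i) hi
    · rfl
    · have := hi i rfl
      rcases h' : V.idxFun i with p | e
      · simp [f, h']
      · simp [h'] at this
  have hP : ∀ K : Set (ι₁ ⊕ ι₂), P (T ∪ f ⁻¹' (some '' K)) = c := by
    intro K
    rw [← hV fun e => e ∈ K]
    congr 1
    ext (_ | i)
    · simp [T]
    · simp only [T, f, Set.mem_union, Set.mem_ofPred_eq, Option.some.injEq, forall_eq',
        Set.mem_preimage, Option.bind_some, Subspace.coe_apply]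
      rcases V.idxFun i with p | e
      · simp
      · simp
  let f₁ : ι₁ ⊕ ι₂ → Option ι₁ := Sum.getLeft?
  let f₂ : ι₁ ⊕ ι₂ → Option ι₂ := Sum.getRight?
  have hf₁ : ∀ e, ∃ i, f₁ i = some e := fun e => ⟨Sum.inl e, rfl⟩
  have hf₂ : ∀ e, ∃ i, f₂ i = some e := fun e => ⟨Sum.inr e, rfl⟩
  by_cases hc : c
  · rcases h₁ fun K => P (f ⁻¹' (some '' (f₁ ⁻¹' (some '' K)))) with h | h
    · exact .inl (HasUnions.succ f hf T hT hTf (fun K => (hP K).symm ▸ hc)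
        (HasUnions.of_label f₁ hf₁ h))
    · exact .inr (HasUnions.of_label f hf (HasUnions.of_label f₁ hf₁ h))
  · rcases h₂ fun K => P (f ⁻¹' (some '' (f₂ ⁻¹' (some '' K)))) with h | h
    · exact .inl (HasUnions.of_label f hf (HasUnions.of_label f₂ hf₂ h))
    · exact .inr (HasUnions.succ f hf T hT hTf (fun K => (hP K).symm ▸ hc)
        (HasUnions.of_label f₂ hf₂ h))

/-- In high dimension, there is a subspace on which the colour of a word over `Option α` only
depends on the set of coordinates where the letter `none` occurs. -/
lemma exists_subspace_colour_eq (α : Type) [Finite α] (M : ℕ) (κ : Type) [Finite κ] :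
    ∃ (ι : Type) (_ : Finite ι), ∀ c : (ι → Option α) → κ, ∃ V : Subspace (Fin M) α ι,
      ∀ x y : Fin M → Option α, (∀ e, x e = none ↔ y e = none) →
        c (lift V x) = c (lift V y) := by
  induction M generalizing κ with
  | zero =>
    exact ⟨Empty, inferInstance, fun c =>
      ⟨⟨fun i => i.elim, fun e => e.elim0⟩, fun x y _ => by
        congr 1; exact Subsingleton.elim _ _⟩⟩
  | succ M ih =>
    obtain ⟨ι₁, _, h₁⟩ := ih (Option α → κ)
    obtain ⟨ι₂, _, h₂⟩ := Line.exists_mono_in_high_dimension α ((ι₁ → Option α) → κ)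
    refine ⟨ι₁ ⊕ ι₂, inferInstance, fun c => ?_⟩
    obtain ⟨l, d, hl⟩ := h₂ fun w u => c (Sum.elim u fun i => some (w i))
    obtain ⟨V, hV⟩ := h₁ fun u o => c (Sum.elim u fun i => (l.idxFun i).elim o some)
    let V' : Subspace (Fin (M + 1)) α (ι₁ ⊕ ι₂) :=
      { idxFun := Sum.elim (fun i => (V.idxFun i).map id Fin.succ)
          fun i => (l.idxFun i).elim (Sum.inr 0) Sum.inl
        proper := fun e => by
          refine Fin.cases ?_ (fun e => ?_) e
          · obtain ⟨i, hi⟩ := l.proper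
            exact ⟨Sum.inr i, by simp [hi]⟩
          · obtain ⟨i, hi⟩ := V.proper e
            exact ⟨Sum.inl i, by simp [hi]⟩ }
    have hV' : ∀ x : Fin (M + 1) → Option α, lift V' x =
        Sum.elim (lift V fun e => x e.succ) fun i => (l.idxFun i).elim (x 0) some := by
      intro x
      funext i
      rcases i with i | i
      · simp only [Subspace.coe_apply, lift, V', Sum.elim_inl]
        cases V.idxFun i <;> simp
      · simp only [Subspace.coe_apply, lift, V', Sum.elim_inr]
        cases l.idxFun i <;> simp
    have hl' : ∀ (u : ι₁ → Option α) (a : α),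
        c (Sum.elim u fun i => (l.idxFun i).elim (some a) some) = d u := by
      intro u a
      rw [← hl a]
      congr 2
      funext i
      simp only [Line.coe_apply]
      cases l.idxFun i <;> rfl
    refine ⟨V', fun x y hxy => ?_⟩
    rw [hV', hV']
    have h := congrFun (hV (fun e => x e.succ) (fun e => y e.succ) fun e => hxy e.succ) (x 0)
    refine h.trans ?_
    rcases hx : x 0 with _ | a
    · rw [(hxy 0).1 hx]
    · rcases hy : y 0 with _ | b
      · simp [(hxy 0).2 hy] at hx
      · exact (hl' _ a).trans (hl' _ b).symm

/-- The **Graham–Rothschild theorem** for two-colourings of variable words in one variable. -/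
theorem exists_subspace_variable_words (α : Type) [Finite α] [Nonempty α] (r s : ℕ) :
    ∃ (ι : Type) (_ : Finite ι), ∀ P : (ι → Option α) → Prop,
      (∃ V : Subspace (Fin r) α ι, ∀ x, (∃ e, x e = none) → P (lift V x)) ∨
      (∃ V : Subspace (Fin s) α ι, ∀ x, (∃ e, x e = none) → ¬ P (lift V x)) := by
  classical
  obtain ⟨ι₀, _, h₀⟩ := exists_hasUnions r s
  obtain ⟨ι, hι, h⟩ := exists_subspace_colour_eq α (Nat.card ι₀) Prop
  let a₀ : α := Classical.arbitrary α
  have key : ∀ (t : ℕ) (P : (ι → Option α) → Prop) (V : Subspace (Fin (Nat.card ι₀)) α ι),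
      (∀ x y : Fin (Nat.card ι₀) → Option α, (∀ e, x e = none ↔ y e = none) →
        P (lift V x) = P (lift V y)) →
      HasUnions ι₀ t (fun K => P (lift V fun e =>
        if (Finite.equivFin ι₀).symm e ∈ K then none else some a₀)) →
      ∃ V : Subspace (Fin t) α ι, ∀ x, (∃ e, x e = none) → P (lift V x) := by
    rintro t P V hV ⟨g, hg, hP⟩
    let g' : Fin (Nat.card ι₀) → Option (Fin t) := fun e => g ((Finite.equivFin ι₀).symm e)
    have hg' : ∀ e, ∃ i, g' i = some e := fun e => by
      obtain ⟨i, hi⟩ := hg e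
      exact ⟨Finite.equivFin ι₀ i, by simp [g', hi]⟩
    refine ⟨comp V (ofLabel g' hg' a₀), fun x hx => ?_⟩
    rw [lift_comp, comp_apply]
    refine (hV _ _ fun e => ?_).mpr (hP {j | x j = none} hx)
    simp only [lift, Subspace.coe_apply, ofLabel, Set.mem_preimage, g']
    cases g ((Finite.equivFin ι₀).symm e) <;> simp
  refine ⟨ι, hι, fun P => ?_⟩
  obtain ⟨V, hV⟩ := h P
  refine (h₀ _).imp (key r P V hV) (key s (fun x => ¬ P x) V ?_)
  intro x y hxy
  rw [hV x y hxy]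

end Ramsey

/-! ### Density Hales–Jewett: consequences for a fixed alphabet -/

section Density

/-- A set of words is line-free if it contains no combinatorial line. -/
def LineFree {β ι : Type*} (A : Set (ι → β)) : Prop := ∀ l : Line β ι, ∃ b, l b ∉ A

lemma LineFree.preimage {β ι η : Type*} {A : Set (ι → β)} (hA : LineFree A)
    (V : Subspace η β ι) : LineFree (V ⁻¹' A) := by
  intro l
  obtain ⟨b, hb⟩ := hA (lineComp V l)
  exact ⟨b, by rwa [lineComp_apply] at hb⟩

/-- In high dimension, line-free sets have density less than `δ`. -/
def DHJAt (β : Type) (δ : ℝ) : Prop :=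
  ∃ n : ℕ, ∀ (ι : Type) [Finite ι], n ≤ Nat.card ι → ∀ A : Set (ι → β), LineFree A → dens A < δ

/-- The density Hales–Jewett property of an alphabet. -/
def DHJ (β : Type) : Prop := ∀ δ > 0, DHJAt β δ

/-- The multidimensional density Hales–Jewett property. -/
lemma DHJ.exists_subspace {β : Type} [Finite β] [Nonempty β] (h : DHJ β) (m : ℕ) {δ : ℝ}
    (hδ : 0 < δ) : ∃ n : ℕ, ∀ (ι : Type) [Finite ι], n ≤ Nat.card ι → ∀ A : Set (ι → β),
      δ ≤ dens A → ∃ V : Subspace (Fin m) β ι, ∀ x, V x ∈ A := by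
  induction m generalizing δ with
  | zero =>
    refine ⟨0, fun ι _ _ A hA => ?_⟩
    obtain ⟨w, hw⟩ : A.Nonempty := by
      by_contra! hcon
      rw [hcon, dens, Set.indicator_empty, avg_const] at hA
      linarith
    exact ⟨⟨fun i => Sum.inl (w i), fun e => e.elim0⟩, fun _ => hw⟩
  | succ m ih =>
    obtain ⟨r, hr⟩ := h (δ / 2) (by linarith)
    by_cases hL : Nonempty (Line β (Fin r))
    swap
    · refine ⟨r, fun ι _ hι A hA => ?_⟩
      have := hr (Fin r) (by simp) Set.univ fun l => (hL ⟨l⟩).elim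
      have h1 := dens_le_one A
      rw [dens, Set.indicator_univ] at this
      have h2 : avg (1 : (Fin r → β) → ℝ) = 1 := avg_const 1
      linarith
    have hLpos : (0 : ℝ) < Nat.card (Line β (Fin r)) := by exact_mod_cast Nat.card_pos
    obtain ⟨n, hn⟩ := ih (δ := δ / (2 * Nat.card (Line β (Fin r)))) (by positivity)
    refine ⟨r + n, fun ι _ hι A hA => ?_⟩
    obtain ⟨e⟩ := nonempty_equiv_sum (ι := ι) (ι₁ := Fin r) (by simp; omega)
    rw [dens, avg_merge e, avg_comm] at hA
    obtain ⟨l, hl⟩ := exists_popular (fun v => {u | merge e u v ∈ A}) hδ hA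
      (fun l : Line β (Fin r) => {v | ∀ b, merge e (l b) v ∈ A}) fun v hv => by
        by_contra! hcon
        exact absurd (hr (Fin r) (by simp) _ fun l => by simpa using hcon l) (not_lt.2 hv)
    obtain ⟨V, hV⟩ := hn _ (by simp; omega) _ hl
    refine ⟨⟨fun i => Sum.elim (fun j => (l.idxFun j).elim (Sum.inr 0) Sum.inl)
      (fun j => (V.idxFun j).map id Fin.succ) (e i), fun t => ?_⟩, fun x => ?_⟩
    · refine Fin.cases ?_ (fun t => ?_) t
      · obtain ⟨i, hi⟩ := l.proper
        exact ⟨e.symm (Sum.inl i), by simp [hi]⟩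
      · obtain ⟨i, hi⟩ := V.proper t
        exact ⟨e.symm (Sum.inr i), by simp [hi]⟩
    · convert hV (fun t => x t.succ) (x 0) using 1
      funext i
      simp only [Subspace.coe_apply, merge]
      rcases e i with j | j
      · simp only [Sum.elim_inl, Line.coe_apply]
        cases l.idxFun j <;> simp
      · simp only [Sum.elim_inr, Subspace.coe_apply]
        cases V.idxFun j <;> simp

/-- A version of the density Hales–Jewett property for families of events. -/
lemma DHJ.exists_line_dens {α : Type} [Finite α] [Nonempty α] (h : DHJ α) {θ : ℝ} (hθ : 0 < θ) :
    ∃ (m : ℕ) (η : ℝ), 0 < η ∧ ∀ (Y : Type) [Finite Y] [Nonempty Y] (B : (Fin m → α) → Set Y),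
      (∀ w, θ ≤ dens (B w)) → ∃ l : Line α (Fin m), η ≤ dens (⋂ a, B (l a)) := by
  obtain ⟨m, hm⟩ := h (θ / 2) (by linarith)
  refine ⟨m, θ / (2 * (Nat.card (Line α (Fin m)) + 1)), by positivity, fun Y _ _ B hB => ?_⟩
  have hE : θ ≤ avg (fun y => dens {w | y ∈ B w}) := by
    have : avg (fun y => dens {w | y ∈ B w}) = avg (fun w => dens (B w)) := avg_comm _
    rw [this]
    exact (avg_const θ).symm.trans_le (avg_mono hB)
  obtain ⟨l, hl⟩ := exists_popular (fun y => {w | y ∈ B w}) hθ hE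
    (fun l : Line α (Fin m) => ⋂ a, B (l a)) fun y hy => by
      by_contra! hcon
      exact absurd (hm (Fin m) (by simp) _ fun l => by simpa using hcon l) (not_lt.2 hy)
  refine ⟨l, le_trans ?_ hl⟩
  have : (0 : ℝ) < Nat.card (Line α (Fin m)) := by
    have : Nonempty (Line α (Fin m)) := ⟨l⟩
    exact_mod_cast Nat.card_pos
  gcongr
  linarith

end Density

/-! ### Insensitive sets -/

section Insensitive

variable {α : Type}

/-- A set of words over `Option α` is `a`-insensitive if membership does not change when letters
`none` and `some a` are interchanged. -/
def Insensitive {ι : Type*} (a : α) (E : Set (ι → Option α)) : Prop :=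
  ∀ x y, fill a x = fill a y → (x ∈ E ↔ y ∈ E)

lemma fill_subspace_congr {η ι : Type*} {a : α} (V : Subspace η (Option α) ι)
    {x y : η → Option α} (h : fill a x = fill a y) : fill a (V x) = fill a (V y) := by
  funext i
  simp only [fill, Subspace.coe_apply]
  rcases V.idxFun i with o | e
  · rfl
  · exact congrFun h e

lemma Insensitive.preimage {η ι : Type*} {a : α} {E : Set (ι → Option α)} (hE : Insensitive a E)
    (V : Subspace η (Option α) ι) : Insensitive a (V ⁻¹' E) :=
  fun _ _ h => hE _ _ (fill_subspace_congr V h)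

lemma Insensitive.compl {ι : Type*} {a : α} {E : Set (ι → Option α)} (hE : Insensitive a E) :
    Insensitive a Eᶜ := fun x y h => not_congr (hE x y h)

/-- The word over `Option α` which agrees with `w` on `J` and is `none` elsewhere. -/
noncomputable def extend {ι : Type*} (J : Finset ι) (w : J → α) : ι → Option α := by
  classical
  exact fun i => if h : i ∈ J then some (w ⟨i, h⟩) else none

/-- An insensitive set with small fibres over the words avoiding `none` on large sets of
coordinates is small. -/
lemma dens_le_of_extend [Finite α] [Nonempty α] {ι : Type} [Finite ι] (E : Set (ι → Option α))
    (δ : ℝ) (hδ : 0 ≤ δ) (n : ℕ)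
    (hE : ∀ J : Finset ι, n ≤ J.card → dens (extend J ⁻¹' E) ≤ δ) :
    dens E ≤ δ + 2 ^ n * ((Nat.card α / 2 + 1) / (Nat.card α + 1)) ^ Nat.card ι := by
  classical
  cases nonempty_fintype α
  cases nonempty_fintype ι
  set k : ℝ := (Nat.card α : ℝ) with hk
  have hk0 : 0 < k := by rw [hk]; exact_mod_cast Nat.card_pos
  have hsub : E.toFinset ⊆ Finset.univ.biUnion
      fun J : Finset ι => (extend J ⁻¹' E).toFinset.image (extend J) := by
    intro x hx
    rw [Set.mem_toFinset] at hx
    have hx' : extend (Finset.univ.filter fun i => (x i).isSome)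
        (fun i => (x i).get (Finset.mem_filter.1 i.2).2) = x := by
      funext i
      rcases hi : x i with _ | b <;> simp [extend, hi]
    simp only [Finset.mem_biUnion, Finset.mem_univ, true_and, Finset.mem_image, Set.mem_toFinset,
      Set.mem_preimage]
    exact ⟨_, _, by rwa [hx'], hx'⟩
  have h1 : (E.ncard : ℝ) ≤ ∑ J : Finset ι, ((extend J ⁻¹' E).ncard : ℝ) := by
    rw [Set.ncard_eq_toFinset_card']
    calc (E.toFinset.card : ℝ) ≤ ((∑ J : Finset ι,
          ((extend J ⁻¹' E).toFinset.image (extend J)).card : ℕ) : ℝ) := by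
            exact_mod_cast (Finset.card_le_card hsub).trans Finset.card_biUnion_le
      _ ≤ _ := by
        push_cast
        refine Finset.sum_le_sum fun J _ => ?_
        rw [Set.ncard_eq_toFinset_card']
        exact_mod_cast Finset.card_image_le
  have h2 : ∀ J : Finset ι, ((extend J ⁻¹' E).ncard : ℝ) ≤
      δ * (k ^ J.card * 1 ^ (Fintype.card ι - J.card)) +
        2 ^ n * ((k / 2) ^ J.card * 1 ^ (Fintype.card ι - J.card)) := by
    intro J
    have hcard : (Nat.card (J → α) : ℝ) = k ^ J.card := by simp [hk]
    have hnc : ((extend J ⁻¹' E).ncard : ℝ) = dens (extend J ⁻¹' E) * k ^ J.card := by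
      rw [dens_eq_ncard, hcard]
      field_simp
    rw [hnc, one_pow, mul_one, mul_one, div_pow]
    rcases le_or_gt n J.card with hJ | hJ
    · have := mul_le_mul_of_nonneg_right (hE J hJ) (pow_nonneg hk0.le J.card)
      have h' : 0 ≤ (2 : ℝ) ^ n * (k ^ J.card / 2 ^ J.card) := by positivity
      linarith
    · have h3 : (2 : ℝ) ^ J.card ≤ 2 ^ n := pow_le_pow_right₀ (by norm_num) hJ.le
      have h4 : dens (extend J ⁻¹' E) * k ^ J.card ≤ 1 * k ^ J.card :=
        mul_le_mul_of_nonneg_right (dens_le_one _) (by positivity)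
      have h5 : 1 * k ^ J.card ≤ 2 ^ n * (k ^ J.card / 2 ^ J.card) := by
        rw [one_mul, ← mul_div_assoc, le_div_iff₀ (by positivity), mul_comm]
        exact mul_le_mul_of_nonneg_right h3 (by positivity)
      have h6 : 0 ≤ δ * k ^ J.card := by positivity
      linarith
  have h3 := h1.trans (Finset.sum_le_sum fun J _ => h2 J)
  rw [Finset.sum_add_distrib, ← Finset.mul_sum, ← Finset.mul_sum,
    Fintype.sum_pow_mul_eq_add_pow, Fintype.sum_pow_mul_eq_add_pow] at h3
  have hcard : (Nat.card (ι → Option α) : ℝ) = (k + 1) ^ Fintype.card ι := by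
    simp [hk]
  rw [dens_eq_ncard, hcard, Nat.card_eq_fintype_card (α := ι), div_le_iff₀ (by positivity),
    add_mul, div_pow, mul_assoc, div_mul_cancel₀ _ (by positivity)]
  exact h3

/-- Dense insensitive sets contain subspaces. -/
lemma DHJ.exists_subspace_insensitive [Finite α] [Nonempty α] (h : DHJ α) (m : ℕ) {γ : ℝ}
    (hγ : 0 < γ) : ∃ n : ℕ, ∀ (ι : Type) [Finite ι], n ≤ Nat.card ι →
      ∀ (a : α) (E : Set (ι → Option α)), Insensitive a E → γ ≤ dens E →
        ∃ V : Subspace (Fin m) (Option α) ι, ∀ x, V x ∈ E := by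
  obtain ⟨r, hr⟩ := h.exists_subspace m (δ := γ / 2) (by linarith)
  set k : ℝ := (Nat.card α : ℝ) with hk
  have hk0 : 0 < k := by rw [hk]; exact_mod_cast Nat.card_pos
  have hlim := (tendsto_pow_atTop_nhds_zero_of_lt_one (r := (k / 2 + 1) / (k + 1))
    (by positivity) (by rw [div_lt_one (by positivity)]; linarith)).const_mul ((2 : ℝ) ^ r)
  rw [mul_zero] at hlim
  obtain ⟨n, hn⟩ := Filter.eventually_atTop.1 (hlim.eventually_lt_const (half_pos hγ))
  refine ⟨n, fun ι _ hι a E hE hdens => ?_⟩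
  by_contra! hcon
  have := dens_le_of_extend E (γ / 2) (by positivity) r fun J hJ => by
    by_contra! hlt
    obtain ⟨V, hV⟩ := hr J (by simpa using hJ) _ hlt.le
    classical
    let V' : Subspace (Fin m) (Option α) ι :=
      { idxFun := fun i => if h : i ∈ J then (V.idxFun ⟨i, h⟩).map some id else Sum.inl none
        proper := fun e => by
          obtain ⟨i, hi⟩ := V.proper e
          exact ⟨i, by simp [hi]⟩ }
    obtain ⟨x, hx⟩ := hcon V'
    refine hx ((hE _ _ ?_).2 (hV (fill a x)))
    funext i
    simp only [fill, Subspace.coe_apply, extend, V']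
    split_ifs with hi
    · cases V.idxFun ⟨i, hi⟩ <;> simp [fill]
    · rfl
  linarith [hn _ hι]

/-- The effect on averages of removing a family of parallel subspaces from the sections of a
set. -/
lemma avg_indicator_remove {β ι ι₁ ι₂ η Y : Type*} [Finite β] [Nonempty β] [Finite ι₁] [Finite ι₂]
    [Finite η] [Finite Y] (e : ι ≃ ι₁ ⊕ ι₂) (V : Subspace η β ι₁) (E : Y → Set (ι → β))
    (P : Set (Y × (ι₂ → β))) (hP : ∀ p ∈ P, ∀ x, merge e (V x) p.2 ∈ E p.1)
    (f : Y → (ι → β) → ℝ) :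
    avg (fun y => avg ((E y).indicator (f y))) =
      avg (fun q : Y × (ι₁ → β) => avg (Set.indicator
        {v | merge e q.2 v ∈ E q.1 ∧ ¬ (q.2 ∈ Set.range V ∧ (q.1, v) ∈ P)}
        fun v => f q.1 (merge e q.2 v))) +
      Nat.card (η → β) / Nat.card (ι₁ → β) *
        avg (P.indicator fun p => avg fun x => f p.1 (merge e (V x) p.2)) := by
  classical
  have h1 : ∀ p : Y × (ι₂ → β), Nat.card (η → β) / Nat.card (ι₁ → β) *
      P.indicator (fun p => avg fun x => f p.1 (merge e (V x) p.2)) p =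
      avg ((Set.range V).indicator fun u =>
        P.indicator (fun p => f p.1 (merge e u p.2)) p) := by
    intro p
    rw [avg_indicator_range (subspace_injective V)]
    by_cases hp : p ∈ P
    · simp [hp]
    · have : avg (fun _ : η → β => (0 : ℝ)) = 0 := avg_const 0
      simp [hp, this]
  rw [← avg_const_mul, avg_prod, avg_prod]
  simp_rw [h1]
  rw [← avg_add]
  congr 1
  funext y
  have h2 : avg (fun v => avg ((Set.range V).indicator fun u =>
      P.indicator (fun p => f p.1 (merge e u p.2)) (y, v))) =
      avg (fun u => avg fun v => (Set.range V).indicator (fun u =>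
        P.indicator (fun p => f p.1 (merge e u p.2)) (y, v)) u) := avg_comm _
  rw [h2, ← avg_add, avg_merge e]
  congr 1
  funext u
  rw [← avg_add]
  congr 1
  funext v
  by_cases hu : u ∈ Set.range V
  · by_cases hp : (y, v) ∈ P
    · have : merge e u v ∈ E y := by
        obtain ⟨x, rfl⟩ := hu
        exact hP _ hp x
      simp [hp, this, hu]
    · simp [hp, Set.indicator_apply]
  · simp [Set.indicator_apply, hu]

lemma avg_indicator_le_dens {X : Type*} [Finite X] {f : X → ℝ} (hf : ∀ x, f x ≤ 1) (E : Set X) :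
    avg (E.indicator f) ≤ dens E :=
  avg_mono fun x => Set.indicator_le_indicator (hf x)

lemma DHJ.avg_indicator_le_aux [Finite α] [Nonempty α] (h : DHJ α) (m : ℕ) {γ : ℝ}
    (hγ : 0 < γ) : ∃ c > 0, ∀ t : ℕ, ∃ n : ℕ, ∀ (ι : Type) [Finite ι], n ≤ Nat.card ι →
      ∀ (Y : Type) [Finite Y] [Nonempty Y] (a : α) (E : Y → Set (ι → Option α)),
      (∀ y, Insensitive a (E y)) → ∀ f : Y → (ι → Option α) → ℝ, (∀ y x, f y x ≤ 1) →
      (∀ y (V : Subspace (Fin m) (Option α) ι), avg (fun x => f y (V x)) ≤ 0) →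
      avg (fun y => dens (E y)) ≤ γ + t * c →
      avg (fun y => avg ((E y).indicator (f y))) ≤ γ := by
  obtain ⟨r, hr⟩ := h.exists_subspace_insensitive m (γ := γ / 2) (by linarith)
  have hsmall : ∀ (ι : Type) [Finite ι] (Y : Type) [Finite Y] (E : Y → Set (ι → Option α))
      (f : Y → (ι → Option α) → ℝ), (∀ y x, f y x ≤ 1) → avg (fun y => dens (E y)) ≤ γ →
      avg (fun y => avg ((E y).indicator (f y))) ≤ γ := fun ι _ Y _ E f hf hE =>
    (avg_mono fun y => avg_indicator_le_dens (hf y) (E y)).trans hE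
  by_cases hL : Nonempty (Subspace (Fin m) (Option α) (Fin r))
  swap
  · refine ⟨1, one_pos, fun t => ⟨r, fun ι _ hι Y _ _ a E hE f hf hV _ => ?_⟩⟩
    have hempty := hr (Fin r) (by simp) a Set.univ (fun _ _ _ => Iff.rfl)
    have h1 : dens (Set.univ : Set (Fin r → Option α)) = 1 := by
      rw [dens, Set.indicator_univ]
      exact avg_const 1
    refine hsmall ι Y E f hf (avg_le_of_forall_le fun y => ?_)
    by_contra! hlt
    obtain ⟨V, -⟩ := hempty (by rw [h1]; linarith [dens_le_one (E y)])
    exact hL ⟨V⟩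
  have hLpos : (0 : ℝ) < Nat.card (Subspace (Fin m) (Option α) (Fin r)) := by
    exact_mod_cast Nat.card_pos
  set K : ℝ := Nat.card (Fin m → Option α) / Nat.card (Fin r → Option α) with hK
  have hK0 : 0 < K := by
    rw [hK]
    refine div_pos ?_ ?_ <;> exact_mod_cast Nat.card_pos
  set c₁ : ℝ := γ / (2 * Nat.card (Subspace (Fin m) (Option α) (Fin r))) with hc₁
  have hc₁0 : 0 < c₁ := by positivity
  refine ⟨K * c₁, by positivity, fun t => ?_⟩
  induction t with
  | zero =>
    refine ⟨0, fun ι _ _ Y _ _ a E _ f hf _ hE => hsmall ι Y E f hf ?_⟩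
    simpa using hE
  | succ t ih =>
    obtain ⟨n, hn⟩ := ih
    refine ⟨r + n, fun ι _ hι Y _ _ a E hE f hf hV hdens => ?_⟩
    rcases le_or_gt (avg fun y => dens (E y)) γ with hle | hlt
    · exact hsmall ι Y E f hf hle
    obtain ⟨e⟩ := nonempty_equiv_sum (ι := ι) (ι₁ := Fin r) (by simp; omega)
    have hpop : γ ≤ avg (fun p : Y × (Fin _ → Option α) => dens {u | merge e u p.2 ∈ E p.1}) := by
      refine hlt.le.trans_eq ?_
      rw [avg_prod]
      congr 1
      funext y
      rw [dens, avg_merge e, avg_comm]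
      rfl
    obtain ⟨V, hVpop⟩ := exists_popular _ hγ hpop
      (fun V : Subspace (Fin m) (Option α) (Fin r) => {p | ∀ x, merge e (V x) p.2 ∈ E p.1})
      fun p hp => hr (Fin r) (by simp) a _ (by
        have := (hE p.1).preimage (horizontal e p.2)
        intro x y hxy
        have := this x y hxy
        rwa [Set.mem_preimage, Set.mem_preimage, horizontal_apply, horizontal_apply] at this) hp
    set P : Set (Y × (Fin _ → Option α)) := {p | ∀ x, merge e (V x) p.2 ∈ E p.1} with hP
    have hremove := avg_indicator_remove e V E P fun p hp => hp
    have hP0 : avg (P.indicator fun p => avg fun x => f p.1 (merge e (V x) p.2)) ≤ 0 := by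
      refine avg_le_of_forall_le fun p => Set.indicator_apply_le' (fun _ => ?_) fun _ => le_rfl
      simpa [comp_apply, horizontal_apply] using hV p.1 (comp (horizontal e p.2) V)
    rw [hremove f]
    have hone := hremove fun _ _ => 1
    have hone' : avg (fun _ : Fin m → Option α => (1 : ℝ)) = 1 := avg_const 1
    simp only [hone'] at hone
    change avg (fun y => dens (E y)) = avg (fun q => dens _) + K * dens P at hone
    have hKP : K * c₁ ≤ K * dens P := mul_le_mul_of_nonneg_left hVpop hK0.le
    refine (add_le_of_nonpos_right (mul_nonpos_of_nonneg_of_nonpos hK0.le hP0)).trans ?_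
    refine hn _ (by simp; omega) _ a _ (fun q => ?_) _ (fun q v => hf _ _) (fun q W => ?_) ?_
    · intro v w hvw
      have h1 : ∀ u, merge e u v ∈ E q.1 ↔ merge e u w ∈ E q.1 := fun u => by
        rw [← vertical_apply, ← vertical_apply]
        exact hE q.1 _ _ (fill_subspace_congr _ hvw)
      simp only [hP, Set.mem_ofPred_eq, h1]
    · simpa [comp_apply, vertical_apply] using hV q.1 (comp (vertical e q.2) W)
    · push_cast at hdens
      linarith

/-- A function whose averages over all subspaces of some dimension are nonpositive has small
average on insensitive sets. -/
lemma DHJ.avg_indicator_le [Finite α] [Nonempty α] (h : DHJ α) (m : ℕ) {γ : ℝ} (hγ : 0 < γ) :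
    ∃ n : ℕ, ∀ (ι : Type) [Finite ι], n ≤ Nat.card ι → ∀ (a : α) (E : Set (ι → Option α)),
      Insensitive a E → ∀ f : (ι → Option α) → ℝ, (∀ x, f x ≤ 1) →
      (∀ V : Subspace (Fin m) (Option α) ι, avg (fun x => f (V x)) ≤ 0) →
      avg (E.indicator f) ≤ γ := by
  obtain ⟨c, hc, hcn⟩ := h.avg_indicator_le_aux m hγ
  obtain ⟨t, ht⟩ := exists_nat_gt (1 / c)
  obtain ⟨n, hn⟩ := hcn t
  refine ⟨n, fun ι _ hι a E hE f hf hV => ?_⟩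
  have := hn ι hι Unit a (fun _ => E) (fun _ => hE) (fun _ => f) (fun _ => hf) (fun _ => hV)
  rw [avg_const, avg_const] at this
  refine this ?_
  rw [div_lt_iff₀ hc] at ht
  linarith [dens_le_one E]

/-- The same bound on complements of intersections of insensitive sets. -/
lemma DHJ.avg_indicator_compl_inter_le [Finite α] [Nonempty α] (h : DHJ α) (s : List α) (m : ℕ)
    {γ : ℝ} (hγ : 0 < γ) : ∃ n : ℕ, ∀ (ι : Type) [Finite ι], n ≤ Nat.card ι →
      ∀ D : α → Set (ι → Option α), (∀ a, Insensitive a (D a)) →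
      ∀ f : (ι → Option α) → ℝ, (∀ x, f x ≤ 1) →
      (∀ V : Subspace (Fin m) (Option α) ι, avg (fun x => f (V x)) ≤ 0) →
      avg (({x | ∀ a ∈ s, x ∈ D a}ᶜ).indicator f) ≤ γ := by
  classical
  induction s generalizing γ with
  | nil =>
    refine ⟨0, fun ι _ _ D _ f _ _ => ?_⟩
    have : avg (fun _ : ι → Option α => (0 : ℝ)) = 0 := avg_const 0
    simpa [this] using hγ.le
  | cons a s ih =>
    obtain ⟨m', hm'⟩ := ih (γ := γ / 4) (by linarith)
    obtain ⟨n₁, hn₁⟩ := h.avg_indicator_le m (γ := γ / 4) (by linarith)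
    obtain ⟨n₂, hn₂⟩ := h.avg_indicator_le m' (γ := γ / 4) (by linarith)
    refine ⟨max n₁ n₂, fun ι _ hι D hD f hf hV => ?_⟩
    set F : Set (ι → Option α) := {x | ∀ a ∈ s, x ∈ D a}ᶜ with hF
    have h1 := hn₁ ι (le_of_max_le_left hι) a _ (hD a).compl f hf hV
    have h2 := hn₂ ι (le_of_max_le_right hι) a _ (hD a) (fun x => F.indicator f x - γ / 4)
      (fun x => by
        have : F.indicator f x ≤ 1 := Set.indicator_apply_le' (fun _ => hf x) fun _ => zero_le_one
        linarith) fun V => by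
          rw [avg_sub, avg_const, sub_nonpos]
          exact hm' (Fin m') (by simp) (fun a => V ⁻¹' D a) (fun a => (hD a).preimage V)
            (fun x => f (V x)) (fun x => hf _) fun W => by
              simpa [comp_apply] using hV (comp V W)
    have h3 : ∀ x, ({x | ∀ b ∈ a :: s, x ∈ D b}ᶜ).indicator f x ≤
        (D a)ᶜ.indicator f x + (D a).indicator (fun x => F.indicator f x - γ / 4) x + γ / 4 := by
      intro x
      simp only [Set.indicator_apply, Set.mem_compl_iff, Set.mem_ofPred_eq, List.forall_mem_cons,
        hF]
      by_cases ha : x ∈ D a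
      · by_cases hs : ∀ b ∈ s, x ∈ D b <;> simp [ha, hs]
      · simp only [ha, false_and, not_false_eq_true, if_true, if_false]
        linarith
    have h4 := avg_mono h3
    rw [avg_add, avg_add, avg_const] at h4
    have h5 : avg (fun x => (D a)ᶜ.indicator f x) ≤ γ / 4 := h1
    linarith

end Insensitive

/-! ### Density Hales–Jewett -/

section Induction

variable {α : Type}

/-- A line-free set does not contain a word with a letter `none` together with all words obtained
by substituting letters for it. -/
lemma LineFree.exists_fill_notMem {ι : Type*} {B : Set (ι → Option α)} (hB : LineFree B)
    {x : ι → Option α} (hx : x ∈ B) (h : ∃ i, x i = none) :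
    ∃ a, (fun i => some (fill a x i)) ∉ B := by
  let l : Line (Option α) ι := ⟨fun i => (x i).map some, by simpa using h⟩
  have hl : l none = x := by
    funext i
    simp only [l, Line.coe_apply]
    cases x i <;> rfl
  obtain ⟨b, hb⟩ := hB l
  rcases b with _ | a
  · exact absurd (hl ▸ hx) hb
  · refine ⟨a, ?_⟩
    have hl' : (fun i => some (fill a x i)) = l (some a) := by
      funext i
      simp only [l, Line.coe_apply, fill]
      cases x i <;> rfl
    rwa [hl']

lemma dens_words_without_none [Finite α] [Nonempty α] (ι : Type) [Finite ι] :
    dens {x : ι → Option α | ∀ i, x i ≠ none} =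
      ((Nat.card α : ℝ) / (Nat.card α + 1)) ^ Nat.card ι := by
  have h : {x : ι → Option α | ∀ i, x i ≠ none} =
      Set.range fun (w : ι → α) (i : ι) => some (w i) := by
    ext x
    constructor
    · intro hx
      choose w hw using fun i => Option.ne_none_iff_exists'.1 (hx i)
      exact ⟨w, funext fun i => (hw i).symm⟩
    · rintro ⟨w, rfl⟩ i
      simp
  have hone : avg (fun _ : ι → α => (1 : ℝ)) = 1 := avg_const 1
  rw [h, dens, avg_indicator_range fun w w' hw => funext fun i => Option.some_injective _
    (congrFun hw i)]
  simp [hone, Nat.card_fun, Finite.card_option, div_pow]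

/-- A line-free set with no density increment on subspaces is small if it contains many sets of
words obtained by substituting letters for `none`. -/
lemma DHJ.dens_le_of_fill [Finite α] [Nonempty α] (h : DHJ α) (m : ℕ) {γ : ℝ} (hγ : 0 < γ) :
    ∃ n : ℕ, ∀ (ι : Type) [Finite ι], n ≤ Nat.card ι → ∀ B : Set (ι → Option α), LineFree B →
      ∀ c, 0 ≤ c → (∀ V : Subspace (Fin m) (Option α) ι, dens (V ⁻¹' B) ≤ c) →
      dens B ≤ γ + c * (1 - dens {x | ∀ a, (fun i => some (fill a x i)) ∈ B}) := by
  classical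
  cases nonempty_fintype α
  obtain ⟨n₁, hn₁⟩ := h.avg_indicator_compl_inter_le (Finset.univ : Finset α).toList m
    (half_pos hγ)
  have hlim := tendsto_pow_atTop_nhds_zero_of_lt_one (r := (Nat.card α : ℝ) / (Nat.card α + 1))
    (by positivity) (by rw [div_lt_one (by positivity)]; linarith)
  obtain ⟨n₂, hn₂⟩ := Filter.eventually_atTop.1 (hlim.eventually_lt_const (half_pos hγ))
  refine ⟨max n₁ n₂, fun ι _ hι B hB c hc hV => ?_⟩
  set D : Set (ι → Option α) := {x | ∀ a, (fun i => some (fill a x i)) ∈ B} with hD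
  have h1 := hn₁ ι (le_of_max_le_left hι) (fun a => {x | (fun i => some (fill a x i)) ∈ B})
    (fun a x y hxy => by simp only [Set.mem_ofPred_eq, hxy])
    (fun x => B.indicator 1 x - c) (fun x => by linarith [indicator_one_le_one B x])
    fun V => by
      rw [avg_sub, avg_const, sub_nonpos]
      exact hV V
  have hDs : {x : ι → Option α | ∀ a ∈ (Finset.univ : Finset α).toList,
      x ∈ {x : ι → Option α | (fun i => some (fill a x i)) ∈ B}} = D := by
    ext x
    simp [hD]
  rw [hDs] at h1
  have h2 : ∀ x, B.indicator (1 : (ι → Option α) → ℝ) x ≤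
      {x : ι → Option α | ∀ i, x i ≠ none}.indicator 1 x +
        Dᶜ.indicator (fun x => B.indicator 1 x - c) x + c * (1 - D.indicator 1 x) := by
    intro x
    by_cases hx : x ∈ D
    · have h0 := indicator_one_nonneg {x : ι → Option α | ∀ i, x i ≠ none} x
      by_cases hxB : x ∈ B
      · have : ∀ i, x i ≠ none := by
          by_contra! hcon
          obtain ⟨a, ha⟩ := hB.exists_fill_notMem hxB hcon
          exact ha (hx a)
        simp [hx, hxB, this]
      · simpa [hx, hxB] using h0
    · have h0 := indicator_one_nonneg {x : ι → Option α | ∀ i, x i ≠ none} x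
      have hx' : x ∈ Dᶜ := hx
      rw [Set.indicator_of_mem hx', Set.indicator_of_notMem hx]
      linarith
  have h3 := avg_mono h2
  rw [avg_add, avg_add, avg_const_mul, avg_sub, avg_const] at h3
  have h4 : avg (fun x => {x : ι → Option α | ∀ i, x i ≠ none}.indicator 1 x) < γ / 2 :=
    (dens_words_without_none ι).trans_lt (hn₂ _ (le_of_max_le_right hι))
  simp only [dens] at h1 ⊢
  linarith

lemma avg_ge_of_le {X : Type*} [Finite X] {f : X → ℝ} {a ε : ℝ} (hf : ∀ x, f x ≤ a + ε)
    (havg : a - ε ≤ avg f) (x : X) : a + ε - 2 * Nat.card X * ε ≤ f x := by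
  classical
  cases nonempty_fintype X
  have : Nonempty X := ⟨x⟩
  have hpos : (0 : ℝ) < Fintype.card X := by exact_mod_cast Fintype.card_pos
  rw [avg_eq, le_div_iff₀ hpos] at havg
  have h1 : ∑ y, (a + ε - f y) ≥ a + ε - f x :=
    Finset.single_le_sum (f := fun y => a + ε - f y) (fun y _ => by linarith [hf y])
      (Finset.mem_univ x)
  rw [Finset.sum_sub_distrib, Finset.sum_const, nsmul_eq_mul, Finset.card_univ] at h1
  rw [Nat.card_eq_fintype_card]
  linarith

lemma DHJAt.mono {β : Type} {δ δ' : ℝ} (h : DHJAt β δ) (hδ : δ ≤ δ') : DHJAt β δ' := by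
  obtain ⟨n, hn⟩ := h
  exact ⟨n, fun ι _ hι A hA => (hn ι hι A hA).trans_le hδ⟩

/-- The threshold density can be lowered. -/
lemma DHJ.exists_dhjAt_sub [Finite α] [Nonempty α] (h : DHJ α) {δ : ℝ} (hδ : 0 < δ)
    (hδ' : ∀ ε > 0, DHJAt (Option α) (δ + ε)) : ∃ ε > 0, DHJAt (Option α) (δ - ε) := by
  obtain ⟨m₀, η₀, hη₀, hline₀⟩ := h.exists_line_dens (half_pos hδ)
  obtain ⟨η, hη, hηδ, hline⟩ : ∃ η > 0, η ≤ δ / 2 ∧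
      ∀ (Y : Type) [Finite Y] [Nonempty Y] (B : (Fin m₀ → α) → Set Y),
      (∀ w, δ / 2 ≤ dens (B w)) → ∃ l : Line α (Fin m₀), η ≤ dens (⋂ a, B (l a)) := by
    refine ⟨min η₀ (δ / 2), by positivity, min_le_right _ _, fun Y _ _ B hB => ?_⟩
    obtain ⟨l, hl⟩ := hline₀ Y B hB
    exact ⟨l, (min_le_left _ _).trans hl⟩
  set ε : ℝ := min (η * δ / 8) (δ / 2) with hε
  have hε0 : 0 < ε := by positivity
  have hε1 : ε ≤ η * δ / 8 := min_le_left _ _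
  have hε2 : ε ≤ δ / 2 := min_le_right _ _
  obtain ⟨m, hm⟩ := hδ' ε hε0
  obtain ⟨m₁, hm₁⟩ := h.dens_le_of_fill m (γ := η * δ / 8) (by positivity)
  obtain ⟨ι₁, _, hGR⟩ := exists_subspace_variable_words α m₁ m₀
  have hM : (0 : ℝ) < Nat.card (ι₁ → Option α) := by exact_mod_cast Nat.card_pos
  set ε' : ℝ := ε / (2 * Nat.card (ι₁ → Option α)) with hε'
  have hε'0 : 0 < ε' := by positivity
  obtain ⟨n, hn⟩ := hδ' ε' hε'0
  refine ⟨ε', hε'0, Nat.card ι₁ + n, fun ι _ hι A hA => ?_⟩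
  by_contra! hdens
  obtain ⟨e⟩ := nonempty_equiv_sum (ι := ι) (ι₁ := ι₁) (by omega)
  set S : (ι₁ → Option α) → Set (Fin (Nat.card ι - Nat.card ι₁) → Option α) :=
    fun u => {v | merge e u v ∈ A} with hS
  have hSdens : ∀ u, δ - ε ≤ dens (S u) := by
    have h1 : ∀ u, dens (S u) ≤ δ + ε' := fun u => by
      refine (hn _ (by simp; omega) _ ?_).le
      have := hA.preimage (vertical e u)
      rwa [show vertical e u ⁻¹' A = S u by
        ext v; rw [Set.mem_preimage, vertical_apply]; rfl] at this
    intro u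
    have h2 := avg_ge_of_le h1 (by rw [dens, avg_merge e] at hdens; exact hdens) u
    have h3 : 2 * Nat.card (ι₁ → Option α) * ε' = ε := by
      rw [hε']
      field_simp
    linarith
  have hSθ : ∀ u, δ / 2 ≤ dens (S u) := fun u => by linarith [hSdens u]
  obtain ⟨V, hV⟩ : ∃ V : Subspace (Fin m₁) α ι₁, ∀ x : Fin m₁ → Option α,
      η ≤ dens (⋂ a, S (fun i => some (fill a (lift V x) i))) := by
    rcases hGR fun x => η ≤ dens (⋂ a, S (fun i => some (fill a x i))) with ⟨V, hV⟩ | ⟨V, hV⟩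
    · refine ⟨V, fun x => ?_⟩
      by_cases hx : ∃ i, x i = none
      · exact hV x hx
      · push Not at hx
        choose w hw using fun i => Option.ne_none_iff_exists'.1 (hx i)
        obtain rfl : x = fun i => some (w i) := funext hw
        simp only [lift_some, fill_some]
        rw [Set.iInter_const]
        exact hηδ.trans (hSθ _)
    · obtain ⟨l, hl⟩ := hline _ (fun w => S fun i => some (V w i)) fun w => hSθ _
      refine absurd ?_ (hV l.idxFun l.proper)
      simp only [fill_lift]
      exact hl
  set A' : (Fin (Nat.card ι - Nat.card ι₁) → Option α) → Set (Fin m₁ → Option α) :=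
    fun y => {x | merge e (lift V x) y ∈ A} with hA'
  have hbound : ∀ y, dens (A' y) ≤ η * δ / 8 +
      (δ + ε) * (1 - dens {x | ∀ a, (fun i => some (fill a x i)) ∈ A' y}) := by
    intro y
    have hfree : LineFree (A' y) := by
      have := (hA.preimage (horizontal e y)).preimage (lift V)
      rwa [show lift V ⁻¹' (horizontal e y ⁻¹' A) = A' y by
        ext x; rw [Set.mem_preimage, Set.mem_preimage, horizontal_apply]; rfl] at this
    exact hm₁ (Fin m₁) (by simp) _ hfree _ (by positivity) fun W =>
      (hm (Fin m) (by simp) _ (hfree.preimage W)).le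
  have h1 := avg_mono hbound
  rw [avg_add, avg_const, avg_const_mul, avg_sub, avg_const] at h1
  have h2 : δ - ε ≤ avg fun y => dens (A' y) := by
    have : avg (fun y => dens (A' y)) = avg fun x => dens (S (lift V x)) := avg_comm _
    rw [this]
    exact (avg_const _).symm.trans_le (avg_mono fun x => hSdens _)
  have h3 : η ≤ avg fun y => dens {x | ∀ a, (fun i => some (fill a x i)) ∈ A' y} := by
    have : avg (fun y => dens {x | ∀ a, (fun i => some (fill a x i)) ∈ A' y}) =
        avg fun x => dens {y | ∀ a, (fun i => some (fill a x i)) ∈ A' y} := avg_comm _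
    rw [this]
    refine (avg_const _).symm.trans_le (avg_mono fun x => (hV x).trans_eq ?_)
    congr 1
    ext y
    simp only [Set.mem_iInter, hS, hA', Set.mem_ofPred_eq, fill_lift, lift_some]
  have h4 := mul_le_mul_of_nonneg_left h3 (show 0 ≤ δ + ε by positivity)
  nlinarith [mul_pos hη hε0, mul_pos hη hδ]

lemma DHJ.option [Finite α] [Nonempty α] (h : DHJ α) : DHJ (Option α) := by
  intro δ₀ hδ₀
  by_contra hcon
  set s : Set ℝ := {δ | DHJAt (Option α) δ} with hs
  have hbdd : ∀ δ ∈ s, δ₀ ≤ δ := fun δ hδ => by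
    by_contra! hlt
    exact hcon (DHJAt.mono hδ hlt.le)
  have hne : s.Nonempty := ⟨2, 0, fun ι _ _ A _ => (dens_le_one A).trans_lt (by norm_num)⟩
  obtain ⟨ε, hε, hlt⟩ := h.exists_dhjAt_sub (hδ₀.trans_le (le_csInf hne hbdd)) fun ε hε => by
    obtain ⟨δ, hδ, hlt⟩ := exists_lt_of_csInf_lt hne (lt_add_of_pos_right _ hε)
    exact DHJAt.mono hδ hlt.le
  linarith [csInf_le ⟨δ₀, hbdd⟩ hlt]

lemma DHJ.of_unique (β : Type) [Unique β] : DHJ β := by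
  refine fun δ hδ => ⟨1, fun ι _ hι A hA => ?_⟩
  have : Nonempty ι := (Nat.card_pos_iff.1 hι).1
  have : A = ∅ := by
    by_contra! hne
    obtain ⟨x, hx⟩ := hne
    obtain ⟨b, hb⟩ := hA (Line.diagonal β ι)
    exact hb (by rwa [Subsingleton.elim (Line.diagonal β ι b) x])
  rw [this, dens, Set.indicator_empty, avg_const]
  exact hδ

lemma DHJ.of_equiv {β β' : Type} [Finite β] (e : β ≃ β') (h : DHJ β) : DHJ β' := by
  intro δ hδ
  obtain ⟨n, hn⟩ := h δ hδ
  refine ⟨n, fun ι _ hι A hA => ?_⟩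
  have := hn ι hι {x | (fun i => e (x i)) ∈ A} fun l => by
    obtain ⟨b, hb⟩ := hA (l.map e)
    refine ⟨e.symm b, ?_⟩
    rwa [← e.apply_symm_apply b, Line.map_apply] at hb
  have : Finite β' := .of_equiv β e
  rwa [dens, ← avg_equiv (Equiv.arrowCongr (Equiv.refl ι) e)]

/-- The **density Hales–Jewett theorem**. -/
theorem dhj_fin (k : ℕ) : DHJ (Fin (k + 1)) := by
  induction k with
  | zero => exact .of_unique (Fin 1)
  | succ k ih => exact ih.option.of_equiv (finSuccEquiv (k + 1)).symm

end Induction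

/-! ### Multiple recurrence -/

section Recurrence

lemma exists_prod_line_eq {M α ι : Type*} [CommMonoid M] [Fintype ι] (t : α → M) (l : Line α ι) :
    ∃ (p : M) (n : ℕ), 1 ≤ n ∧ ∀ a, ∏ i, t (l a i) = t a ^ n * p := by
  classical
  refine ⟨∏ i, (l.idxFun i).elim 1 t, (Finset.univ.filter fun i => l.idxFun i = none).card,
    Finset.card_pos.2 ?_, fun a => ?_⟩
  · obtain ⟨i, hi⟩ := l.proper
    exact ⟨i, by simpa using hi⟩
  · rw [← Finset.prod_const, Finset.prod_filter, ← Finset.prod_mul_distrib]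
    refine Finset.prod_congr rfl fun i _ => ?_
    rw [Line.coe_apply]
    cases l.idxFun i <;> simp

variable {X : Type*} [MeasurableSpace X] {μ : Measure X} [IsProbabilityMeasure μ]

/-- The averages of the return densities along a finite family of measure-preserving maps. -/
lemma integral_dens_preimage {W : Type*} [Finite W] [Nonempty W] {S : W → X → X}
    (hS : ∀ w, MeasurePreserving (S w) μ μ) {A : Set X} (hA : MeasurableSet A) :
    ∫ x, dens {w | S w x ∈ A} ∂μ = μ.real A := by
  cases nonempty_fintype W
  have hind : ∀ x w, {w | S w x ∈ A}.indicator (1 : W → ℝ) w = (S w ⁻¹' A).indicator 1 x :=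
    fun _ _ => rfl
  simp only [dens, avg_eq, hind]
  have h_integrable : ∀ w, Integrable (fun x => (S w ⁻¹' A).indicator (1 : X → ℝ) x) μ := fun w =>
    (integrable_const (1 : ℝ)).indicator ((hS w).measurable hA)
  rw [integral_div, integral_finsetSum _ fun w _ => h_integrable w]
  have : ∀ w, ∫ x, (S w ⁻¹' A).indicator (1 : X → ℝ) x ∂μ = μ.real A := fun w => by
    rw [integral_indicator_one ((hS w).measurable hA), (hS w).measureReal_preimage
      hA.nullMeasurableSet]
  simp [this]

theorem exists_measure_iInter_preimage_pos {k : ℕ} {T : Fin (k + 1) → X → X}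
    (hT : ∀ i, MeasurePreserving (T i) μ μ) (hcomm : ∀ i j, T i ∘ T j = T j ∘ T i)
    {A : Set X} (hA : MeasurableSet A) (hpos : 0 < μ A) :
    ∃ n : ℕ, 1 ≤ n ∧ 0 < μ (⋂ i, (T i)^[n] ⁻¹' A) := by
  by_contra! hcon
  have hδ : 0 < μ.real A := ENNReal.toReal_pos hpos.ne' (measure_ne_top _ _)
  obtain ⟨N, hN⟩ := dhj_fin k (μ.real A / 2) (half_pos hδ)
  let M : Submonoid (Function.End X) := Submonoid.closure (Set.range T)
  have : IsMulCommutative M := Submonoid.isMulCommutative_closure _ (by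
    rintro _ ⟨i, rfl⟩ _ ⟨j, rfl⟩
    exact hcomm i j)
  let _ : CommMonoid M := { mul_comm := mul_comm' }
  have hM : ∀ g : M, MeasurePreserving (g : Function.End X) μ μ := fun g => by
    refine Submonoid.closure_induction (fun _ ⟨i, hi⟩ => hi ▸ hT i) (MeasurePreserving.id μ)
      (fun _ _ _ _ hf hg => hf.comp hg) g.2
  let t : Fin (k + 1) → M := fun i => ⟨T i, Submonoid.subset_closure ⟨i, rfl⟩⟩
  let S : (Fin N → Fin (k + 1)) → X → X := fun w => ((∏ i, t (w i) : M) : Function.End X)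
  have hnull : ∀ l : Line (Fin (k + 1)) (Fin N), ∀ᵐ x ∂μ, ∃ a, S (l a) x ∉ A := by
    intro l
    obtain ⟨p, n, hn, hl⟩ := exists_prod_line_eq t l
    have h0 : ∀ᵐ x ∂μ, x ∉ ⋂ i, (T i)^[n] ⁻¹' A :=
      measure_eq_zero_iff_ae_notMem.1 (le_antisymm (hcon n hn) bot_le)
    filter_upwards [(hM p).quasiMeasurePreserving.ae h0] with x hx
    simp only [Set.mem_iInter, not_forall] at hx
    obtain ⟨a, ha⟩ := hx
    refine ⟨a, ?_⟩
    have hS : S (l a) x = (T a)^[n] ((p : Function.End X) x) := by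
      simp only [S, hl, Submonoid.coe_mul, SubmonoidClass.coe_pow, t]
      rfl
    rwa [hS]
  have hle : ∀ᵐ x ∂μ, dens {w | S w x ∈ A} ≤ μ.real A / 2 := by
    filter_upwards [ae_all_iff.2 hnull] with x hx
    exact (hN (Fin N) (by simp) {w | S w x ∈ A} hx).le
  have h1 := integral_mono_of_nonneg (Filter.Eventually.of_forall fun x => dens_nonneg _)
    (integrable_const _) hle
  rw [integral_dens_preimage (fun w => hM _) hA, integral_const, probReal_univ, one_smul] at h1
  linarith

end Recurrence

end DensityHalesJewett

/-- **Furstenberg multiple recurrence theorem.** If `T 1, …, T k` are pairwise commuting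
measurable measure-preserving maps on a probability space and `A` is measurable with
`μ A > 0`, then there is `n ≥ 1` with `μ (⋂ i, (T i)^{-n} A) > 0`. -/
theorem furstenberg_multiple_recurrence {X : Type*} [MeasurableSpace X] (μ : Measure X)
    [IsProbabilityMeasure μ] (k : ℕ) (hk : 1 ≤ k) (T : Fin k → X → X)
    (hTmeas : ∀ i, Measurable (T i))
    (hTpres : ∀ i, ∀ A : Set X, MeasurableSet A → μ (T i ⁻¹' A) = μ A)
    (hTcomm : ∀ i j, T i ∘ T j = T j ∘ T i)
    (A : Set X) (hA : MeasurableSet A) (hApos : 0 < μ A) :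
    ∃ n : ℕ, 1 ≤ n ∧ 0 < μ (⋂ i : Fin k, (T i)^[n] ⁻¹' A) := by
  obtain ⟨k, rfl⟩ := Nat.exists_eq_add_of_le' hk
  exact DensityHalesJewett.exists_measure_iInter_preimage_pos
    (fun i => ⟨hTmeas i, Measure.ext fun B hB => by
      rw [Measure.map_apply (hTmeas i) hB, hTpres i B hB]⟩) hTcomm hA hApos
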